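/- Let Γ be a finite-index subgroup of SL₂(ℤ), let p, q be integers with p + q > 0, and let z, w ∈ ℂ∖ℝ be such that γ·z ∉ {w, conj w} for every γ ∈ Γ. Then the family γ ↦ j_γ(w)^{−p}·j_γ(conj w)^{−q}·ψ^{p,q}(z, γ·w), indexed by γ ∈ Γ, is summable, and Σ_{γ∈Γ} j_γ(z)^{−(p+q+2)}·ψ^{p,q}(γ·z, w) = Σ_{γ∈Γ} j_γ(w)^{−p}·j_γ(conj w)^{−q}·ψ^{p,q}(z, γ·w). -/

import Mathlib

/- STATEMENT 5: The alternative expression of the Poincaré series `Ψ_Γ^{p,q}`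
as an average over `w`: summability of the second family and equality of the
two sums. -/

open Complex ComplexConjugate

noncomputable section

abbrev SL2Z := Matrix.SpecialLinearGroup (Fin 2) ℤ

/-- The real matrix associated to an element of `SL₂(ℤ)`. -/
def toRealM (γ : SL2Z) : Matrix (Fin 2) (Fin 2) ℝ :=
  γ.val.map fun n => (n : ℝ)

/-- Automorphy factor `j_γ(z) = c·z + d` for a real matrix `γ = (a, b; c, d)`. -/
def jFac (γ : Matrix (Fin 2) (Fin 2) ℝ) (z : ℂ) : ℂ :=
  ((γ 1 0 : ℝ) : ℂ) * z + ((γ 1 1 : ℝ) : ℂ)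

/-- Möbius action `γ·z = (a·z + b)/(c·z + d)`. -/
def moeb (γ : Matrix (Fin 2) (Fin 2) ℝ) (z : ℂ) : ℂ :=
  (((γ 0 0 : ℝ) : ℂ) * z + ((γ 0 1 : ℝ) : ℂ)) / (((γ 1 0 : ℝ) : ℂ) * z + ((γ 1 1 : ℝ) : ℂ))

/-- `ψ^{p,q}(z,w) = (w − conj w)/((z − w)^(p+1)·(z − conj w)^(q+1))`. -/
def psiPQ (p q : ℤ) (z w : ℂ) : ℂ :=
  (w - conj w) / ((z - w) ^ (p + 1) * (z - conj w) ^ (q + 1))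

open Asymptotics Filter

theorem toRealM_apply (γ : SL2Z) (i j : Fin 2) : toRealM γ i j = (γ.val i j : ℝ) := rfl

theorem SL2Z.det_eq (γ : SL2Z) :
    γ.val 0 0 * γ.val 1 1 - γ.val 0 1 * γ.val 1 0 = 1 := by
  rw [← Matrix.det_fin_two, γ.det_coe]

theorem SL2Z.det_eq_complex (γ : SL2Z) :
    (γ.val 0 0 : ℂ) * γ.val 1 1 - γ.val 0 1 * γ.val 1 0 = 1 := by
  exact_mod_cast γ.det_eq

/-- The Euclidean norm of the vector of entries of an element of `SL₂(ℤ)`. -/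
def entryNorm (γ : SL2Z) : ℝ :=
  √((γ.val 0 0 : ℝ) ^ 2 + (γ.val 0 1 : ℝ) ^ 2 + (γ.val 1 0 : ℝ) ^ 2 + (γ.val 1 1 : ℝ) ^ 2)

theorem entryNorm_sq (γ : SL2Z) : entryNorm γ ^ 2 =
    (γ.val 0 0 : ℝ) ^ 2 + (γ.val 0 1 : ℝ) ^ 2 + (γ.val 1 0 : ℝ) ^ 2 + (γ.val 1 1 : ℝ) ^ 2 :=
  Real.sq_sqrt (by positivity)

theorem entryNorm_nonneg (γ : SL2Z) : 0 ≤ entryNorm γ := Real.sqrt_nonneg _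

theorem bottomRow_sq_pos (γ : SL2Z) : 0 < γ.val 1 0 ^ 2 + γ.val 1 1 ^ 2 := by
  by_contra! hle
  have hc : γ.val 1 0 = 0 := by nlinarith [sq_nonneg (γ.val 1 0), sq_nonneg (γ.val 1 1)]
  have hd : γ.val 1 1 = 0 := by nlinarith [sq_nonneg (γ.val 1 0), sq_nonneg (γ.val 1 1)]
  have := γ.det_eq
  simp [hc, hd] at this

theorem one_le_entryNorm (γ : SL2Z) : 1 ≤ entryNorm γ := by
  have h : (1 : ℝ) ≤ (γ.val 1 0 : ℝ) ^ 2 + (γ.val 1 1 : ℝ) ^ 2 := by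
    exact_mod_cast bottomRow_sq_pos γ
  have := entryNorm_sq γ
  nlinarith [entryNorm_nonneg γ, sq_nonneg (γ.val 0 0 : ℝ), sq_nonneg (γ.val 0 1 : ℝ)]

/-- The integer part of `Re (γ·i)`. -/
def translationPart (γ : SL2Z) : ℤ :=
  (γ.val 0 0 * γ.val 1 0 + γ.val 0 1 * γ.val 1 1) / (γ.val 1 0 ^ 2 + γ.val 1 1 ^ 2)

theorem injective_bottomRow_translationPart :
    Function.Injective fun γ : SL2Z ↦ (γ.val 1, translationPart γ) := by
  intro γ δ hγδ
  obtain ⟨hrow, hn⟩ := Prod.mk.inj hγδ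
  have hc : δ.val 1 0 = γ.val 1 0 := (congrFun hrow 0).symm
  have hd : δ.val 1 1 = γ.val 1 1 := (congrFun hrow 1).symm
  have hD := bottomRow_sq_pos γ
  have hγ := γ.det_eq
  have hδ := δ.det_eq
  simp only [translationPart] at hn
  rw [hc, hd] at hn hδ
  set k := γ.val 0 0 * δ.val 0 1 - δ.val 0 0 * γ.val 0 1
  have ha : δ.val 0 0 = γ.val 0 0 + k * γ.val 1 0 := by
    linear_combination γ.val 0 0 * hδ - δ.val 0 0 * hγ
  have hb : δ.val 0 1 = γ.val 0 1 + k * γ.val 1 1 := by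
    linear_combination γ.val 0 1 * hδ - δ.val 0 1 * hγ
  rw [show δ.val 0 0 * γ.val 1 0 + δ.val 0 1 * γ.val 1 1 =
      γ.val 0 0 * γ.val 1 0 + γ.val 0 1 * γ.val 1 1 + k * (γ.val 1 0 ^ 2 + γ.val 1 1 ^ 2) by
    rw [ha, hb]; ring, Int.add_mul_ediv_right _ _ hD.ne'] at hn
  have hk : k = 0 := left_eq_add.1 hn
  rw [hk, zero_mul, add_zero] at ha hb
  ext i j
  fin_cases i <;> fin_cases j <;> simp [ha, hb, hc, hd]

theorem bottomRow_norm_sq_mul_le (γ : SL2Z) :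
    ‖γ.val 1‖ ^ 2 * (1 + (translationPart γ : ℝ) ^ 2) ≤ 3 * entryNorm γ ^ 2 := by
  have hD := bottomRow_sq_pos γ
  have hnorm : ‖γ.val 1‖ ^ 2 ≤ (γ.val 1 0 : ℝ) ^ 2 + (γ.val 1 1 : ℝ) ^ 2 := by
    rw [← Real.le_sqrt (norm_nonneg _) (by positivity),
      pi_norm_le_iff_of_nonneg (Real.sqrt_nonneg _)]
    intro i
    apply Real.le_sqrt_of_sq_le
    fin_cases i <;> simp [Int.norm_eq_abs, sq_abs, sq_nonneg]
  have hlow := Int.ediv_mul_le (γ.val 0 0 * γ.val 1 0 + γ.val 0 1 * γ.val 1 1) hD.ne'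
  have hupp := Int.lt_ediv_add_one_mul_self
    (γ.val 0 0 * γ.val 1 0 + γ.val 0 1 * γ.val 1 1) hD
  rw [← translationPart] at hlow hupp
  have hint : (γ.val 1 0 ^ 2 + γ.val 1 1 ^ 2) * (1 + translationPart γ ^ 2) ≤
      3 * (γ.val 0 0 ^ 2 + γ.val 0 1 ^ 2 + γ.val 1 0 ^ 2 + γ.val 1 1 ^ 2) := by
    generalize translationPart γ = n at *
    generalize γ.val 0 0 = a at *
    generalize γ.val 0 1 = b at *
    generalize γ.val 1 0 = c at *
    generalize γ.val 1 1 = d at *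
    refine le_of_mul_le_mul_left ?_ hD
    have hcs : (a * c + b * d) ^ 2 ≤ (a ^ 2 + b ^ 2) * (c ^ 2 + d ^ 2) := by
      nlinarith [sq_nonneg (a * d - b * c)]
    nlinarith [mul_nonneg (sub_nonneg.2 hlow) (sub_nonneg.2 hupp.le), sq_nonneg
      (2 * (a * c + b * d) - n * (c ^ 2 + d ^ 2)), mul_pos hD hD]
  rw [entryNorm_sq]
  calc _ ≤ ((γ.val 1 0 : ℝ) ^ 2 + (γ.val 1 1 : ℝ) ^ 2) * (1 + (translationPart γ : ℝ) ^ 2) := by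
        gcongr
    _ ≤ _ := by exact_mod_cast hint

theorem summable_inv_one_add_int_sq : Summable fun n : ℤ ↦ (1 + (n : ℝ) ^ 2)⁻¹ := by
  refine (Real.summable_one_div_int_pow.2 one_lt_two).of_norm_bounded_eventually ?_
  filter_upwards [(Set.finite_singleton (0 : ℤ)).compl_mem_cofinite] with n hn
  have : (0 : ℝ) < (n : ℝ) ^ 2 := by
    have : (n : ℝ) ≠ 0 := by exact_mod_cast hn
    positivity
  rw [Real.norm_of_nonneg (by positivity), one_div]
  gcongr
  linarith

theorem summable_inv_entryNorm_pow_three : Summable fun γ : SL2Z ↦ (entryNorm γ ^ 3)⁻¹ := by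
  have hsum := ((EisensteinSeries.summable_one_div_norm_rpow (k := 3) (by norm_num)).mul_of_nonneg
    summable_inv_one_add_int_sq (fun _ ↦ by positivity) (fun _ ↦ by positivity)).comp_injective
    injective_bottomRow_translationPart
  refine (hsum.mul_left (√3 ^ 3)).of_nonneg_of_le
    (fun γ ↦ inv_nonneg.2 (pow_nonneg (entryNorm_nonneg γ) _)) fun γ ↦ ?_
  have hx : 0 < ‖γ.val 1‖ := by
    refine norm_pos_iff.2 fun h0 ↦ (bottomRow_sq_pos γ).ne' ?_
    simp [h0]
  have hM := one_le_entryNorm γ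
  have hle := bottomRow_norm_sq_mul_le γ
  simp only [Function.comp_apply]
  rw [Real.rpow_neg hx.le, show (3 : ℝ) = (3 : ℕ) by norm_num, Real.rpow_natCast, ← mul_inv,
    ← div_eq_mul_inv, inv_eq_one_div, div_le_div_iff₀ (by positivity) (by positivity), one_mul,
    ← mul_pow]
  set n : ℝ := (translationPart γ : ℝ)
  have hn : √(1 + n ^ 2) ^ 2 = 1 + n ^ 2 := Real.sq_sqrt (by positivity)
  have hn1 : 1 ≤ √(1 + n ^ 2) := Real.one_le_sqrt.2 (by nlinarith [sq_nonneg n])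
  calc ‖γ.val 1‖ ^ 3 * (1 + n ^ 2) ≤ ‖γ.val 1‖ ^ 3 * √(1 + n ^ 2) ^ 3 := by
        exact mul_le_mul_of_nonneg_left (hn.ge.trans (pow_le_pow_right₀ hn1 (Nat.le_succ 2)))
          (by positivity)
    _ = (‖γ.val 1‖ * √(1 + n ^ 2)) ^ 3 := (mul_pow ..).symm
    _ ≤ (√(3 : ℕ) * entryNorm γ) ^ 3 := by
        refine pow_le_pow_left₀ (by positivity) (abs_le_of_sq_le_sq' ?_ (by positivity)).2 3
        rw [mul_pow, mul_pow, hn, Real.sq_sqrt (by positivity)]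
        exact_mod_cast hle

theorem tendsto_entryNorm_cofinite : Tendsto entryNorm cofinite atTop := by
  have h := summable_inv_entryNorm_pow_three.tendsto_cofinite_zero
  have h' : Tendsto (fun γ ↦ (entryNorm γ ^ 3)⁻¹) cofinite (nhdsWithin 0 (Set.Ioi 0)) :=
    tendsto_nhdsWithin_iff.2 ⟨h, .of_forall fun γ ↦
      inv_pos.2 (pow_pos (one_pos.trans_le (one_le_entryNorm γ)) 3)⟩
  have h3 : Tendsto (fun γ ↦ entryNorm γ ^ 3) cofinite atTop := 
    h'.inv_tendsto_nhdsGT_zero.congr fun γ ↦ inv_inv _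
  refine tendsto_atTop.2 fun b ↦ ?_
  filter_upwards [tendsto_atTop.1 h3 (|b| ^ 3)] with γ hγ
  exact (le_abs_self b).trans (le_of_pow_le_pow_left₀ three_ne_zero (entryNorm_nonneg γ) hγ)

/-- The numerator `z·(c·u + d) − (a·u + b)` of `z − γ·u`. -/
def subMoebNum (z u : ℂ) (γ : SL2Z) : ℂ :=
  z * ((γ.val 1 0 : ℂ) * u + γ.val 1 1) - ((γ.val 0 0 : ℂ) * u + γ.val 0 1)

theorem subMoebNum_isBigO (z u : ℂ) (l : Filter SL2Z) :
    subMoebNum z u =O[l] entryNorm := by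
  have h (i j : Fin 2) : (fun γ : SL2Z ↦ (γ.val i j : ℂ)) =O[l] entryNorm := by
    refine .of_norm_le fun γ ↦ ?_
    rw [Complex.norm_intCast]
    apply Real.abs_le_sqrt
    fin_cases i <;> fin_cases j <;> simp <;> nlinarith [sq_nonneg (γ.val 0 0 : ℝ),
      sq_nonneg (γ.val 0 1 : ℝ), sq_nonneg (γ.val 1 0 : ℝ), sq_nonneg (γ.val 1 1 : ℝ)]
  refine .sub (.const_mul_left (.add ?_ (h 1 1)) _) (.add ?_ (h 0 1))
  · simpa only [mul_comm] using (h 1 0).const_mul_left u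
  · simpa only [mul_comm] using (h 0 0).const_mul_left u

theorem isBigO_of_mul_ofReal_sub {α : Type*} {l : Filter α} {z : ℂ} (hz : z.im ≠ 0)
    {x y S : α → ℝ} (h : (fun t ↦ z * x t - y t) =O[l] S) : x =O[l] S ∧ y =O[l] S := by
  have hx : x =O[l] S := by
    have him : (fun t ↦ z.im * x t) =O[l] S :=
      (IsBigO.of_norm_le fun t ↦ by
        simpa using Complex.abs_im_le_norm (z * x t - y t)).trans h.norm_left
    exact (isBigO_const_mul_left_iff hz).1 him
  refine ⟨hx, ?_⟩
  have hre : (fun t ↦ z.re * x t - y t) =O[l] S :=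
    (IsBigO.of_norm_le fun t ↦ by
      simpa using Complex.abs_re_le_norm (z * x t - y t)).trans h.norm_left
  simpa using (hx.const_mul_left z.re).sub hre

theorem entryNorm_isBigO {z w : ℂ} (hz : z.im ≠ 0) (hw : w.im ≠ 0) (l : Filter SL2Z) :
    entryNorm =O[l] fun γ ↦ ‖subMoebNum z w γ‖ + ‖subMoebNum z (conj w) γ‖ := by
  set S : SL2Z → ℝ := fun γ ↦ ‖subMoebNum z w γ‖ + ‖subMoebNum z (conj w) γ‖
  have hww : w - conj w ≠ 0 := by
    rw [Complex.sub_conj]; simpa using hw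
  have hA : subMoebNum z w =O[l] S := .of_norm_le fun γ ↦ by simp [S]
  have hB : subMoebNum z (conj w) =O[l] S := .of_norm_le fun γ ↦ by simp [S]
  have hac : (fun γ : SL2Z ↦ z * ((γ.val 1 0 : ℝ) : ℂ) - ((γ.val 0 0 : ℝ) : ℂ)) =O[l] S := by
    rw [← isBigO_const_mul_left_iff hww]
    refine (hA.sub hB).congr_left fun γ ↦ ?_
    simp only [subMoebNum]
    push_cast
    ring
  have hbd : (fun γ : SL2Z ↦ z * ((γ.val 1 1 : ℝ) : ℂ) - ((γ.val 0 1 : ℝ) : ℂ)) =O[l] S := by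
    refine (hA.sub (hac.const_mul_left w)).congr_left fun γ ↦ ?_
    simp only [subMoebNum]
    push_cast
    ring
  obtain ⟨hc, ha⟩ := isBigO_of_mul_ofReal_sub hz hac
  obtain ⟨hd, hb⟩ := isBigO_of_mul_ofReal_sub hz hbd
  refine .trans (.of_norm_le fun γ ↦ ?_)
    (((ha.norm_left.add hb.norm_left).add hc.norm_left).add hd.norm_left)
  rw [Real.norm_of_nonneg (entryNorm_nonneg γ)]
  simp only [Real.norm_eq_abs]
  refine Real.sqrt_le_iff.2 ⟨by positivity, ?_⟩
  rw [← sq_abs (γ.val 0 0 : ℝ), ← sq_abs (γ.val 0 1 : ℝ), ← sq_abs (γ.val 1 0 : ℝ),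
    ← sq_abs (γ.val 1 1 : ℝ)]
  have h₁ := abs_nonneg (γ.val 0 0 : ℝ)
  have h₂ := abs_nonneg (γ.val 0 1 : ℝ)
  have h₃ := abs_nonneg (γ.val 1 0 : ℝ)
  have h₄ := abs_nonneg (γ.val 1 1 : ℝ)
  nlinarith [mul_nonneg h₁ h₂, mul_nonneg (add_nonneg h₁ h₂) h₃,
    mul_nonneg (add_nonneg (add_nonneg h₁ h₂) h₃) h₄]

/-- The determinant condition makes `|z − γ·w|²` and `|z − γ·w̄|²` differ, after clearing
denominators, by a constant. -/
theorem normSq_subMoebNum_conj (z w : ℂ) (γ : SL2Z) :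
    ‖subMoebNum z (conj w) γ‖ ^ 2 = ‖subMoebNum z w γ‖ ^ 2 + 4 * z.im * w.im := by
  have hdet : (γ.val 0 0 : ℝ) * γ.val 1 1 - γ.val 0 1 * γ.val 1 0 = 1 := by
    exact_mod_cast γ.det_eq
  simp only [← Complex.normSq_eq_norm_sq, Complex.normSq_apply, subMoebNum, Complex.sub_re,
    Complex.sub_im, Complex.mul_re, Complex.mul_im, Complex.add_re, Complex.add_im,
    Complex.conj_re, Complex.conj_im, Complex.intCast_re, Complex.intCast_im]
  linear_combination (4 * z.im * w.im) * hdet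

theorem subMoebNum_isTheta {z w : ℂ} (hz : z.im ≠ 0) (hw : w.im ≠ 0) :
    subMoebNum z w =Θ[cofinite] entryNorm := by
  refine ⟨subMoebNum_isBigO z w _, ?_⟩
  obtain ⟨C, hC, hbound⟩ := (entryNorm_isBigO hz hw cofinite).exists_pos
  set k : ℝ := √|4 * z.im * w.im|
  have hk : k ^ 2 = |4 * z.im * w.im| := Real.sq_sqrt (abs_nonneg _)
  refine .of_bound (4 * C) ?_
  filter_upwards [hbound.bound, tendsto_atTop.1 tendsto_entryNorm_cofinite (2 * C * k)]
    with γ hγ hlarge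
  rw [Real.norm_of_nonneg (entryNorm_nonneg γ), Real.norm_of_nonneg (by positivity)] at *
  have hB : ‖subMoebNum z (conj w) γ‖ ≤ ‖subMoebNum z w γ‖ + k := by
    refine (abs_le_of_sq_le_sq' ?_ (by positivity)).2
    have := mul_nonneg (norm_nonneg (subMoebNum z w γ)) (Real.sqrt_nonneg |4 * z.im * w.im|)
    rw [normSq_subMoebNum_conj]
    nlinarith [le_abs_self (4 * z.im * w.im)]
  nlinarith

theorem jFac_ne_zero (γ : SL2Z) {z : ℂ} (hz : z.im ≠ 0) : jFac (toRealM γ) z ≠ 0 := by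
  intro h
  simp only [jFac, toRealM_apply] at h
  have him := congrArg Complex.im h
  have hre := congrArg Complex.re h
  simp [hz] at him
  simp [him] at hre
  simpa [him, hre] using bottomRow_sq_pos γ

theorem conj_moeb (γ : Matrix (Fin 2) (Fin 2) ℝ) (z : ℂ) :
    conj (moeb γ z) = moeb γ (conj z) := by
  simp [moeb]

theorem sub_moeb (γ : SL2Z) (z : ℂ) {u : ℂ} (hu : u.im ≠ 0) :
    z - moeb (toRealM γ) u = subMoebNum z u γ / jFac (toRealM γ) u := by
  have hj := jFac_ne_zero γ hu
  rw [eq_div_iff hj, sub_mul, moeb, ← jFac, div_mul_cancel₀ _ hj]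
  simp [subMoebNum, jFac, toRealM_apply]

theorem moeb_inv_sub (γ : SL2Z) {z : ℂ} (hz : z.im ≠ 0) (u : ℂ) :
    moeb (toRealM γ⁻¹) z - u = subMoebNum z u γ / jFac (toRealM γ⁻¹) z := by
  have hj := jFac_ne_zero γ⁻¹ hz
  rw [eq_div_iff hj, sub_mul, moeb, ← jFac, div_mul_cancel₀ _ hj]
  simp [subMoebNum, jFac, toRealM_apply, Matrix.SpecialLinearGroup.coe_inv,
    Matrix.adjugate_fin_two]
  ring

theorem moeb_sub_conj (γ : SL2Z) {w : ℂ} (hw : w.im ≠ 0) :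
    moeb (toRealM γ) w - moeb (toRealM γ) (conj w) =
      (w - conj w) / (jFac (toRealM γ) w * jFac (toRealM γ) (conj w)) := by
  have h₁ := jFac_ne_zero γ hw
  have h₂ := jFac_ne_zero γ (z := conj w) (by simpa using hw)
  have hdet := γ.det_eq_complex
  rw [moeb, moeb, ← jFac, ← jFac, div_sub_div _ _ h₁ h₂]
  congr 1
  simp only [jFac, toRealM_apply, Complex.ofReal_intCast]
  linear_combination (w - conj w) * hdet

theorem jFac_zpow_mul_psiPQ_moeb_right (γ : SL2Z) (p q : ℤ) (z : ℂ) {w : ℂ} (hw : w.im ≠ 0) :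
    jFac (toRealM γ) w ^ (-p) * jFac (toRealM γ) (conj w) ^ (-q) *
        psiPQ p q z (moeb (toRealM γ) w) =
      (w - conj w) / (subMoebNum z w γ ^ (p + 1) * subMoebNum z (conj w) γ ^ (q + 1)) := by
  have hw' : (conj w).im ≠ 0 := by simpa using hw
  have h₁ := jFac_ne_zero γ hw
  have h₂ := jFac_ne_zero γ hw'
  rw [psiPQ, conj_moeb, moeb_sub_conj γ hw, sub_moeb γ z hw, sub_moeb γ z hw', div_zpow, div_zpow,
    zpow_add_one₀ h₁, zpow_add_one₀ h₂, zpow_neg, zpow_neg]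
  generalize subMoebNum z w γ ^ (p + 1) = A, subMoebNum z (conj w) γ ^ (q + 1) = B
  have h₃ := zpow_ne_zero p h₁
  have h₄ := zpow_ne_zero q h₂
  field_simp

theorem jFac_inv_zpow_mul_psiPQ_moeb_left (γ : SL2Z) (p q : ℤ) {z : ℂ} (hz : z.im ≠ 0) (w : ℂ) :
    jFac (toRealM γ⁻¹) z ^ (-(p + q + 2)) * psiPQ p q (moeb (toRealM γ⁻¹) z) w =
      (w - conj w) / (subMoebNum z w γ ^ (p + 1) * subMoebNum z (conj w) γ ^ (q + 1)) := by
  have h₁ := jFac_ne_zero γ⁻¹ hz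
  rw [psiPQ, moeb_inv_sub γ hz, moeb_inv_sub γ hz, div_zpow, div_zpow, zpow_neg,
    show p + q + 2 = (p + 1) + (q + 1) by ring, zpow_add₀ h₁]
  generalize subMoebNum z w γ ^ (p + 1) = A, subMoebNum z (conj w) γ ^ (q + 1) = B
  have h₃ := zpow_ne_zero (p + 1) h₁
  have h₄ := zpow_ne_zero (q + 1) h₁
  field_simp

theorem summable_div_subMoebNum_zpow {p q : ℤ} (hpq : 0 < p + q) {z w : ℂ} (hz : z.im ≠ 0)
    (hw : w.im ≠ 0) (K : ℂ) :
    Summable fun γ : SL2Z ↦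
      K / (subMoebNum z w γ ^ (p + 1) * subMoebNum z (conj w) γ ^ (q + 1)) := by
  have hw' : (conj w).im ≠ 0 := by simpa using hw
  have hΘ := (((subMoebNum_isTheta hz hw).zpow (p + 1)).mul
    ((subMoebNum_isTheta hz hw').zpow (q + 1))).inv
  refine summable_of_isBigO summable_inv_entryNorm_pow_three ?_
  simp only [div_eq_mul_inv]
  refine (hΘ.isBigO.const_mul_left K).trans (.of_norm_le fun γ ↦ ?_)
  have hM := one_le_entryNorm γ
  have hM0 := one_pos.trans_le hM
  rw [← zpow_add₀ hM0.ne', Real.norm_of_nonneg (by positivity), ← zpow_natCast]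
  gcongr
  push_cast
  lia

theorem statement_5
    (Γ : Subgroup SL2Z) (hΓ : Γ.FiniteIndex)
    (p q : ℤ) (hpq : 0 < p + q)
    (z w : ℂ) (hz : z.im ≠ 0) (hw : w.im ≠ 0)
    (h : ∀ γ : Γ, moeb (toRealM ↑γ) z ≠ w ∧ moeb (toRealM ↑γ) z ≠ conj w) :
    Summable (fun γ : Γ =>
      jFac (toRealM ↑γ) w ^ (-p) * jFac (toRealM ↑γ) (conj w) ^ (-q) *
        psiPQ p q z (moeb (toRealM ↑γ) w)) ∧
    (∑' γ : Γ, jFac (toRealM ↑γ) z ^ (-(p + q + 2)) * psiPQ p q (moeb (toRealM ↑γ) z) w) =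
      ∑' γ : Γ, jFac (toRealM ↑γ) w ^ (-p) * jFac (toRealM ↑γ) (conj w) ^ (-q) *
        psiPQ p q z (moeb (toRealM ↑γ) w) := by
  constructor
  · simp only [jFac_zpow_mul_psiPQ_moeb_right _ p q z hw]
    exact (summable_div_subMoebNum_zpow hpq hz hw _).comp_injective Subtype.val_injective
  rw [← (Equiv.inv Γ).tsum_eq]
  refine tsum_congr fun γ ↦ ?_
  rw [jFac_zpow_mul_psiPQ_moeb_right _ p q z hw, Equiv.inv_apply, Subgroup.coe_inv,
    jFac_inv_zpow_mul_psiPQ_moeb_left _ p q hz w]
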